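/- arXiv:1105.3620 — 2 statements merged into one kernel-verified Lean document; each statement's English description precedes it below -/
import Mathlib

section
/- Let φ be an AM-chain-homotopy for a chain complex C of ℤ-modules, let π be the associated family of maps, and let M be the subcomplex of C with M_q = im π_q and differential the restriction of ∂. Then the inclusion M ↪ C induces an isomorphism of homology groups H_q(M) ≅ H_q(C) for every q. -/
attribute [local instance 2000] Submodule.module

/-- The cycles of a chain complex `C` of `ℤ`-modules with differentials
`d n : C (n+1) → C n` (so `∂_q = d (q-1)` for `q ≥ 1`, and `∂_0 = 0`, whence every
`0`-chain is a cycle). -/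
def cyc (C : ℕ → Type*) [∀ n, AddCommGroup (C n)] [∀ n, Module ℤ (C n)]
    (d : ∀ n, C (n + 1) →ₗ[ℤ] C n) : ∀ q, Submodule ℤ (C q)
  | 0 => ⊤
  | (q + 1) => LinearMap.ker (d q)

/-- Let `φ` be an AM-chain-homotopy for a chain complex `C` of `ℤ`-modules,
`π` the associated family of maps, and `M` the subcomplex with `M_q = im π_q` and
differential the restriction of `∂`.  Then the inclusion `M ↪ C` induces an isomorphism
`H_q(M) ≅ H_q(C)` for every `q`.  Here the `q`-cycles of `M` are `im π_q ⊓ ker ∂_q`, the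
`q`-boundaries of `M` are `∂_{q+1}(im π_{q+1})`, and homology is cycles modulo
boundaries. -/
theorem am_homotopy_inclusion_induces_homology_iso
    (C : ℕ → Type*) [∀ n, AddCommGroup (C n)] [∀ n, Module ℤ (C n)]
    (d : ∀ n, C (n + 1) →ₗ[ℤ] C n)
    (hdd : ∀ n, (d n).comp (d (n + 1)) = 0)
    (φ : ∀ n, C n →ₗ[ℤ] C (n + 1))
    (hφφ : ∀ n, (φ (n + 1)).comp (φ n) = 0)
    (hφdφ : ∀ n, (φ n).comp ((d n).comp (φ n)) = φ n)
    (π : ∀ n, C n →ₗ[ℤ] C n)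
    (hπ0 : π 0 = LinearMap.id - (d 0).comp (φ 0))
    (hπ : ∀ n, π (n + 1) =
      LinearMap.id - (φ n).comp (d n) - (d (n + 1)).comp (φ (n + 1))) :
    ∀ q, ∃ e :
      -- H_q(M): cycles of M modulo boundaries of M
      (↥(LinearMap.range (π q) ⊓ cyc C d q) ⧸
        (Submodule.map (d q) (LinearMap.range (π (q + 1)))).comap
          (LinearMap.range (π q) ⊓ cyc C d q).subtype) ≃ₗ[ℤ]
      -- H_q(C): cycles of C modulo boundaries of C
      (↥(cyc C d q) ⧸ (LinearMap.range (d q)).comap (cyc C d q).subtype),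
      -- the isomorphism is induced by the inclusion M ↪ C
      ∀ x : ↥(LinearMap.range (π q) ⊓ cyc C d q),
        e (Submodule.Quotient.mk x) =
          Submodule.Quotient.mk (Submodule.inclusion inf_le_right x) := by
  have edd : ∀ n x, d n (d (n + 1) x) = 0 := fun n x => LinearMap.congr_fun (hdd n) x
  have eff : ∀ n x, φ (n + 1) (φ n x) = 0 := fun n x => LinearMap.congr_fun (hφφ n) x
  have efdf : ∀ n x, φ n (d n (φ n x)) = φ n x := fun n x => LinearMap.congr_fun (hφdφ n) x
  have p0 : ∀ x, π 0 x = x - d 0 (φ 0 x) := fun x => by rw [hπ0]; rfl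
  have p1 : ∀ n x, π (n + 1) x = x - φ n (d n x) - d (n + 1) (φ (n + 1) x) :=
    fun n x => by rw [hπ]; rfl
  have hidem : ∀ q x, π q (π q x) = π q x := by
    intro q x
    cases q with
    | zero => simp [p0, efdf]
    | succ n => simp [p1, efdf, eff, edd]
  have hcomm : ∀ q x, d q (π (q + 1) x) = π q (d q x) := by
    intro q x
    cases q with
    | zero => simp [p0, p1, edd]
    | succ n => simp [p1, edd]
  have hcyc : ∀ q x, d q x ∈ cyc C d q := by
    intro q x
    cases q with
    | zero => exact Submodule.mem_top
    | succ n => exact edd n x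
  have hz : ∀ q z, z ∈ cyc C d q → π q z = z - d q (φ q z) := by
    intro q z h
    cases q with
    | zero => exact p0 z
    | succ n =>
      have h' : d n z = 0 := h
      simp [p1, h']
  intro q
  let f := Submodule.mapQ
    ((Submodule.map (d q) (LinearMap.range (π (q + 1)))).comap
          (LinearMap.range (π q) ⊓ cyc C d q).subtype)
    ((LinearMap.range (d q)).comap (cyc C d q).subtype)
    (Submodule.inclusion inf_le_right) (by
      rintro x ⟨y, -, hy⟩
      exact ⟨y, hy⟩)
  refine ⟨(AddEquiv.ofBijective f.toAddMonoidHom ⟨?_, ?_⟩).toIntLinearEquiv, fun x => rfl⟩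
  · rw [injective_iff_map_eq_zero]
    intro a
    obtain ⟨x, rfl⟩ := Submodule.Quotient.mk_surjective _ a
    intro h
    obtain ⟨w, hw⟩ := (Submodule.Quotient.mk_eq_zero _).1 h
    obtain ⟨x, ⟨y, rfl⟩, hx⟩ := x
    have hw' : d q w = π q y := hw
    refine (Submodule.Quotient.mk_eq_zero _).2 ⟨π (q + 1) w, ⟨w, rfl⟩, ?_⟩
    change d q (π (q + 1) w) = π q y
    rw [hcomm, hw', hidem]
  · intro b
    obtain ⟨⟨z, hzc⟩, rfl⟩ := Submodule.Quotient.mk_surjective _ b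
    refine ⟨Submodule.Quotient.mk ⟨π q z, ⟨z, rfl⟩, ?_⟩, ?_⟩
    · rw [hz q z hzc]
      exact Submodule.sub_mem _ hzc (hcyc q _)
    · refine (Submodule.Quotient.eq _).2 ⟨- φ q z, ?_⟩
      change d q (- φ q z) = π q z - z
      rw [hz q z hzc, map_neg]
      abel
end

section
/- Let φ be an AM-chain-homotopy for a chain complex C of ℤ-modules and let π be the associated family of maps. If moreover ∂_q ∘ π_q = 0 for every q (i.e., the differential vanishes on the subcomplex M with M_q = im π_q), then H_q(C) is isomorphic as a ℤ-module to im π_q for every q. -/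
attribute [local instance 2000] Submodule.module

theorem am_lin {A B : Type*} [AddCommGroup A] [AddCommGroup B] [Module ℤ A] [Module ℤ B]
    (h : Nonempty (A ≃+ B)) : Nonempty (A ≃ₗ[ℤ] B) := by
  obtain ⟨e⟩ := h
  exact ⟨{ e with map_smul' := fun c x => map_intCast_smul e ℤ ℤ c x }⟩

theorem am_aux {R M : Type*} [Ring R] [AddCommGroup M] [Module R M]
    (Z B : Submodule R M) (p : M →ₗ[R] M) (hB : ∀ x ∈ B, p x = 0)
    (hZ : ∀ x ∈ Z, p x = 0 → x ∈ B) (hpZ : ∀ x, p x ∈ Z) (hpp : ∀ x, p (p x) = p x) :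
    Nonempty ((↥Z ⧸ B.comap Z.subtype) ≃+ ↥(LinearMap.range p)) := by
  let f : Z →ₗ[R] LinearMap.range p := p.rangeRestrict.comp Z.subtype
  have hk : B.comap Z.subtype = LinearMap.ker f := by
    ext x
    have : f x = 0 ↔ p x = 0 := by
      rw [Subtype.ext_iff]; rfl
    rw [LinearMap.mem_ker, this]
    exact ⟨fun h => hB _ h, fun h => hZ _ x.2 h⟩
  have hs : Function.Surjective f := by
    rintro ⟨_, x, rfl⟩
    exact ⟨⟨p x, hpZ x⟩, Subtype.ext (hpp x)⟩
  exact ⟨(Submodule.quotEquivOfEq _ _ hk).trans (f.quotKerEquivOfSurjective hs) |>.toAddEquiv⟩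

/-- Let `φ` be an AM-chain-homotopy for a chain complex `C` of `ℤ`-modules
and `π` the associated family of maps.  If moreover `∂_q ∘ π_q = 0` for every `q` (i.e.
the differential vanishes on the subcomplex `M` with `M_q = im π_q`; the case `q = 0` is
automatic since `∂_0 = 0`), then `H_q(C) = ker ∂_q / im ∂_{q+1}` is isomorphic as a
`ℤ`-module to `im π_q` for every `q`. -/
theorem am_homotopy_homology_iso_image_pi
    (C : ℕ → Type*) [∀ n, AddCommGroup (C n)] [∀ n, Module ℤ (C n)]
    (d : ∀ n, C (n + 1) →ₗ[ℤ] C n)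
    (hdd : ∀ n, (d n).comp (d (n + 1)) = 0)
    (φ : ∀ n, C n →ₗ[ℤ] C (n + 1))
    (hφφ : ∀ n, (φ (n + 1)).comp (φ n) = 0)
    (hφdφ : ∀ n, (φ n).comp ((d n).comp (φ n)) = φ n)
    (π : ∀ n, C n →ₗ[ℤ] C n)
    (hπ0 : π 0 = LinearMap.id - (d 0).comp (φ 0))
    (hπ : ∀ n, π (n + 1) =
      LinearMap.id - (φ n).comp (d n) - (d (n + 1)).comp (φ (n + 1)))
    (hdπ : ∀ q, (d q).comp (π (q + 1)) = 0) :
    ∀ q, Nonempty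
      ((↥(cyc C d q) ⧸ (LinearMap.range (d q)).comap (cyc C d q).subtype) ≃ₗ[ℤ]
        ↥(LinearMap.range (π q))) := by
  have hdd' : ∀ n x, d n (d (n + 1) x) = 0 := fun n x => LinearMap.congr_fun (hdd n) x
  have hff : ∀ n x, φ (n + 1) (φ n x) = 0 := fun n x => LinearMap.congr_fun (hφφ n) x
  have hfdf : ∀ n x, φ n (d n (φ n x)) = φ n x := fun n x => LinearMap.congr_fun (hφdφ n) x
  have h0 : ∀ x, π 0 x = x - d 0 (φ 0 x) := fun x => LinearMap.congr_fun hπ0 x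
  have h1 : ∀ n x, π (n + 1) x = x - φ n (d n x) - d (n + 1) (φ (n + 1) x) :=
    fun n x => LinearMap.congr_fun (hπ n) x
  have hdp : ∀ n x, d n (π (n + 1) x) = 0 := fun n x => LinearMap.congr_fun (hdπ n) x
  have hdfd : ∀ n x, d n (φ n (d n x)) = d n x := by
    intro n x
    have h := hdp n x
    rw [h1, map_sub, map_sub, hdd', sub_zero, sub_eq_zero] at h
    exact h.symm
  intro q
  cases q with
  | zero =>
    refine am_lin (am_aux (cyc C d 0) (LinearMap.range (d 0)) (π 0) ?_ ?_ ?_ ?_)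
    · rintro _ ⟨x, rfl⟩
      rw [h0, hdfd, sub_self]
    · intro x _ h
      rw [h0, sub_eq_zero] at h
      exact ⟨_, h.symm⟩
    · intro x
      exact Submodule.mem_top
    · intro x
      rw [h0 (π 0 x), h0 x, map_sub, hfdf, sub_self, map_zero, sub_zero]
  | succ q =>
    refine am_lin (am_aux (cyc C d (q + 1)) (LinearMap.range (d (q + 1))) (π (q + 1)) ?_ ?_ ?_ ?_)
    · rintro _ ⟨x, rfl⟩
      rw [h1, hdfd, hdd', map_zero, sub_zero, sub_self]
    · intro x hx h
      have hx' : d q x = 0 := hx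
      rw [h1, hx', map_zero, sub_zero, sub_eq_zero] at h
      exact ⟨_, h.symm⟩
    · intro x
      exact hdp q x
    · intro x
      have hfp : φ (q + 1) (π (q + 1) x) = 0 := by
        rw [h1, map_sub, map_sub, hff, hfdf, sub_zero, sub_self]
      rw [h1 q (π (q + 1) x), hdp, hfp, map_zero, map_zero, sub_zero, sub_zero]
end
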